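/- arXiv:2506.23453 — 3 statements merged into one kernel-verified Lean document; each statement's English description precedes it below -/
import Mathlib

section
/- For every natural number q ≥ 1 and all real numbers a, b: ((a + b)^q − a^q)² ≤ q²·4^{q−1}·(a^{2q−2}·b² + b^{2q}). -/
/-- Pointwise error decomposition for `q`-th powers: the squared error of the
`q`-th power is bounded by a semi-parametric influence term plus a propagated
estimation error, up to the explicit constant `q² · 4^(q-1)`. -/
theorem sq_pow_error_decomposition (q : ℕ) (hq : 1 ≤ q) (a b : ℝ) :
    ((a + b) ^ q - a ^ q) ^ 2 ≤
      (q : ℝ) ^ 2 * 4 ^ (q - 1) * (a ^ (2 * q - 2) * b ^ 2 + b ^ (2 * q)) := by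
  obtain ⟨n, rfl⟩ := Nat.exists_eq_add_of_le' hq
  have hdiff := abs_pow_sub_pow_le (a + b) a (n + 1)
  rw [add_sub_cancel_left, Nat.add_sub_cancel] at hdiff
  have hmax : max |a + b| |a| ≤ 2 * max |a| |b| := by
    have ha := le_max_left |a| |b|
    have hb := le_max_right |a| |b|
    exact max_le (by linarith [abs_add_le a b]) (by linarith [abs_nonneg a])
  have hpow : (max |a| |b|) ^ (2 * n) ≤ a ^ (2 * n) + b ^ (2 * n) := by
    have ha : 0 ≤ a ^ (2 * n) := (even_two_mul n).pow_nonneg a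
    have hb : 0 ≤ b ^ (2 * n) := (even_two_mul n).pow_nonneg b
    rcases max_choice |a| |b| with h | h <;> rw [h, (even_two_mul n).pow_abs] <;> linarith
  calc ((a + b) ^ (n + 1) - a ^ (n + 1)) ^ 2
      = |(a + b) ^ (n + 1) - a ^ (n + 1)| ^ 2 := (sq_abs _).symm
    _ ≤ (|b| * (n + 1 : ℕ) * (2 * max |a| |b|) ^ n) ^ 2 := by
        gcongr
        exact hdiff.trans (by gcongr)
    _ = ((n + 1 : ℕ) : ℝ) ^ 2 * 4 ^ n * ((max |a| |b|) ^ (2 * n) * b ^ 2) := by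
        rw [← sq_abs b, show (4 : ℝ) ^ n = 2 ^ (2 * n) by rw [pow_mul]; norm_num]
        ring
    _ ≤ ((n + 1 : ℕ) : ℝ) ^ 2 * 4 ^ n * ((a ^ (2 * n) + b ^ (2 * n)) * b ^ 2) := by
        gcongr
    _ = _ := by
        rw [Nat.add_sub_cancel, show 2 * (n + 1) - 2 = 2 * n by omega]
        ring
end

section
/- (Method of two fuzzy hypotheses.) Let Θ and X be measurable spaces, let P be a Markov kernel from Θ to X (so P_θ is a probability measure on X for each θ ∈ Θ, measurably in θ), and let F : Θ → ℝ be measurable. Let μ₀, μ₁ be probability measures on Θ and suppose there exist c ∈ ℝ, Δ > 0, and β₀, β₁ ∈ [0,1] such that μ₀({θ : F(θ) ≤ c − Δ}) ≥ 1 − β₀ and μ₁({θ : F(θ) ≥ c + Δ}) ≥ 1 − β₁. Define the mixture probability measures P₀, P₁ on X by Pⱼ(A) = ∫ P_θ(A) dμⱼ(θ) for measurable A ⊆ X, and let V := sup over measurable A ⊆ X of |P₀(A) − P₁(A)| be their total variation distance. Then for every measurable estimator F̂ : X → ℝ, sup_{θ ∈ Θ} P_θ({x : |F̂(x) − F(θ)|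 ≥ Δ}) ≥ (1 − V − β₀ − β₁)/2. -/
open MeasureTheory ProbabilityTheory

/-- If a kernel gives `A` mass at most `S` on a set of parameters of prior mass at least `1 - β`,
then the mixture gives `A` mass at most `S + β`. -/
theorem measureReal_bind_le_add {Θ X : Type*} [MeasurableSpace Θ] [MeasurableSpace X]
    (P : ProbabilityTheory.Kernel Θ X) [IsMarkovKernel P] (μ : Measure Θ) [IsProbabilityMeasure μ]
    {T : Set Θ} (hT : MeasurableSet T) {A : Set X} (hA : MeasurableSet A) {S β : ℝ}
    (hS : 0 ≤ S) (hβ : β ∈ Set.Icc (0 : ℝ) 1) (hμ : ENNReal.ofReal (1 - β) ≤ μ T)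
    (h : ∀ θ ∈ T, (P θ).real A ≤ S) :
    (μ.bind (fun θ => P θ)).real A ≤ S + β := by
  have hTc : μ Tᶜ ≤ ENNReal.ofReal β := by
    rw [prob_compl_eq_one_sub hT]
    refine (tsub_le_tsub_left hμ 1).trans_eq ?_
    rw [← ENNReal.ofReal_one, ← ENNReal.ofReal_sub _ (by linarith [hβ.2]), sub_sub_cancel]
  have key : (μ.bind (fun θ => P θ)) A ≤ ENNReal.ofReal (S + β) := by
    rw [Measure.bind_apply hA P.measurable.aemeasurable, ENNReal.ofReal_add hS hβ.1]
    calc ∫⁻ θ, P θ A ∂μ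
        ≤ ∫⁻ θ, (ENNReal.ofReal S + Tᶜ.indicator 1 θ) ∂μ := by
          refine lintegral_mono fun θ => ?_
          by_cases hθ : θ ∈ T
          · refine le_add_right ?_
            rw [← ofReal_measureReal]
            exact ENNReal.ofReal_le_ofReal (h θ hθ)
          · rw [Set.indicator_of_mem (Set.mem_compl hθ)]
            exact le_add_left prob_le_one
      _ = ENNReal.ofReal S + μ Tᶜ := by
          rw [lintegral_add_left measurable_const, lintegral_indicator_one hT.compl]
          simp
      _ ≤ ENNReal.ofReal S + ENNReal.ofReal β := by gcongr
  exact ENNReal.toReal_le_of_le_ofReal (add_nonneg hS hβ.1) key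

/-- Method of two fuzzy hypotheses: if the two priors `μ₀, μ₁` put mass at least
`1 - β₀`, resp. `1 - β₁`, on parameters whose functional value is `≤ c - Δ`,
resp. `≥ c + Δ`, then any estimator errs by at least `Δ` with worst-case
probability at least `(1 - V - β₀ - β₁)/2`, where `V` is the total variation
distance between the two mixture distributions. -/
theorem two_fuzzy_hypotheses
    {Θ X : Type*} [MeasurableSpace Θ] [MeasurableSpace X]
    (P : ProbabilityTheory.Kernel Θ X) [IsMarkovKernel P]
    (F : Θ → ℝ) (hF : Measurable F)
    (μ₀ μ₁ : Measure Θ) [IsProbabilityMeasure μ₀] [IsProbabilityMeasure μ₁]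
    (c Δ : ℝ) (hΔ : 0 < Δ) (β₀ β₁ : ℝ)
    (hβ₀ : β₀ ∈ Set.Icc (0 : ℝ) 1) (hβ₁ : β₁ ∈ Set.Icc (0 : ℝ) 1)
    (hμ₀ : ENNReal.ofReal (1 - β₀) ≤ μ₀ {θ | F θ ≤ c - Δ})
    (hμ₁ : ENNReal.ofReal (1 - β₁) ≤ μ₁ {θ | c + Δ ≤ F θ})
    (P₀ P₁ : Measure X)
    (hP₀ : P₀ = μ₀.bind (fun θ => P θ))
    (hP₁ : P₁ = μ₁.bind (fun θ => P θ))
    (V : ℝ)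
    (hV : V = ⨆ A : {A : Set X // MeasurableSet A},
      |(P₀ A.1).toReal - (P₁ A.1).toReal|) :
    ∀ Fhat : X → ℝ, Measurable Fhat →
      (1 - V - β₀ - β₁) / 2 ≤ ⨆ θ, (P θ {x | Δ ≤ |Fhat x - F θ|}).toReal := by
  intro Fhat hFhat
  set S := ⨆ θ, (P θ {x | Δ ≤ |Fhat x - F θ|}).toReal
  have hbdd : BddAbove (Set.range fun θ => (P θ {x | Δ ≤ |Fhat x - F θ|}).toReal) :=
    ⟨1, by rintro _ ⟨θ, rfl⟩; exact measureReal_le_one⟩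
  have hS : 0 ≤ S := Real.iSup_nonneg fun θ => ENNReal.toReal_nonneg
  have le_S {A : Set X} {θ : Θ} (h : A ⊆ {x | Δ ≤ |Fhat x - F θ|}) : (P θ).real A ≤ S :=
    (measureReal_mono h).trans (le_ciSup hbdd θ)
  have hA : MeasurableSet {x | c ≤ Fhat x} := measurableSet_le measurable_const hFhat
  have h₀ : P₀.real {x | c ≤ Fhat x} ≤ S + β₀ := by
    rw [hP₀]
    refine measureReal_bind_le_add P μ₀ (measurableSet_le hF measurable_const) hA hS hβ₀ hμ₀
      fun θ hθ => le_S fun x hx => ?_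
    simp only [Set.mem_ofPred_eq] at hθ hx ⊢
    exact le_abs.2 (Or.inl (by linarith))
  have h₁ : P₁.real {x | c ≤ Fhat x}ᶜ ≤ S + β₁ := by
    rw [hP₁]
    refine measureReal_bind_le_add P μ₁ (measurableSet_le measurable_const hF) hA.compl hS hβ₁ hμ₁
      fun θ hθ => le_S fun x hx => ?_
    simp only [Set.mem_ofPred_eq, Set.mem_compl_iff, not_le] at hθ hx ⊢
    exact le_abs.2 (Or.inr (by linarith))
  have : IsProbabilityMeasure P₀ := hP₀ ▸ inferInstanceAs (IsProbabilityMeasure (μ₀.bind P))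
  have : IsProbabilityMeasure P₁ := hP₁ ▸ inferInstanceAs (IsProbabilityMeasure (μ₁.bind P))
  have hV_ge : |P₀.real {x | c ≤ Fhat x} - P₁.real {x | c ≤ Fhat x}| ≤ V := by
    rw [hV]
    refine le_ciSup (f := fun A : {A : Set X // MeasurableSet A} =>
      |(P₀ A.1).toReal - (P₁ A.1).toReal|) ⟨1, ?_⟩ ⟨_, hA⟩
    rintro _ ⟨A, rfl⟩
    exact abs_sub_le_of_nonneg_of_le ENNReal.toReal_nonneg measureReal_le_one
      ENNReal.toReal_nonneg measureReal_le_one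
  rw [probReal_compl_eq_one_sub hA] at h₁
  linarith [neg_le_of_abs_le hV_ge]
end

section
/- (Properties of the moving least squares weights.) Fix natural numbers d ≥ 1 and s ≥ 1 and let Ω = [0,1]^d ⊆ ℝ^d. There exist constants a₁ > 0, a₂ > 0, and ρ₀ > 0, depending only on d and s, such that for every n ∈ ℕ and every tuple of points x₁,…,xₙ ∈ Ω whose covering radius ρ := sup_{y ∈ Ω} min_{1 ≤ i ≤ n} ‖y − xᵢ‖ satisfies ρ ≤ ρ₀, there exist continuous functions u₁,…,uₙ : Ω → ℝ with the following properties: (i) for every polynomial π in d variables of total degree at most s − 1 and every y ∈ Ω, π(y) = ∑_{i=1}^n π(xᵢ)·uᵢ(y); (ii) ∑_{i=1}^n |uᵢ(y)| ≤ a₁ for every y ∈ Ω; (iii) uᵢ(y) = 0 for every y ∈ Ω and every i with ‖xᵢ − y‖ ≥ a₂·ρ. -/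
open MeasureTheory

/-- The unit cube `[0, 1]^d`. -/
def unitCube (d : ℕ) : Set (EuclideanSpace ℝ (Fin d)) :=
  {z | ∀ j, z j ∈ Set.Icc (0 : ℝ) 1}

/-- The values at `y` of all monomials of degree at most `m` in each variable. -/
def monomialVec (d m : ℕ) (y : EuclideanSpace ℝ (Fin d)) (α : Fin d → Fin (m + 1)) : ℝ :=
  ∏ j, y j ^ (α j : ℕ)

lemma continuous_monomialVec (d m : ℕ) : Continuous (monomialVec d m) := by
  unfold monomialVec
  fun_prop

lemma isClosed_unitCube (d : ℕ) : IsClosed (unitCube d) := by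
  have h : unitCube d = ⋂ j, (fun z : EuclideanSpace ℝ (Fin d) => z j) ⁻¹' Set.Icc 0 1 := by
    ext; simp [unitCube]
  rw [h]
  exact isClosed_iInter fun j => isClosed_Icc.preimage (by fun_prop)

lemma norm_le_of_mem_unitCube {d : ℕ} {z : EuclideanSpace ℝ (Fin d)} (hz : z ∈ unitCube d) :
    ‖z‖ ≤ √d := by
  rw [EuclideanSpace.norm_eq]
  apply Real.sqrt_le_sqrt
  calc ∑ j, ‖z j‖ ^ 2 ≤ ∑ _j : Fin d, (1 : ℝ) :=
        Finset.sum_le_sum fun j _ => by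
          rw [Real.norm_of_nonneg (hz j).1]
          exact pow_le_one₀ (hz j).1 (hz j).2
    _ = d := by simp

lemma convex_unitCube (d : ℕ) : Convex ℝ (unitCube d) := by
  intro x hx y hy a b ha hb hab j
  simpa using convex_Icc (0 : ℝ) 1 (hx j) (hy j) ha hb hab

lemma infinite_unitCube {d : ℕ} (hd : 1 ≤ d) : (unitCube d).Infinite := by
  refine Set.infinite_of_injOn_mapsTo (s := Set.Icc (0 : ℝ) 1)
    (f := fun t => WithLp.toLp 2 (fun _ : Fin d => t)) ?_ ?_ (Set.Icc_infinite one_pos)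
  · intro s _ t _ h
    simpa using congrArg (fun z : EuclideanSpace ℝ (Fin d) => z ⟨0, hd⟩) h
  · intro t ht j
    simpa using ht

lemma span_monomialVec_unitCube (d m : ℕ) :
    Submodule.span ℝ (Set.range fun y : unitCube d => monomialVec d m y) = ⊤ := by
  classical
  by_contra hne
  obtain ⟨f, hf0, hf⟩ := Submodule.exists_le_ker_of_lt_top _ (lt_top_iff_ne_top.2 hne)
  let e : (Fin d → Fin (m + 1)) → (Fin d →₀ ℕ) :=
    fun α => Finsupp.equivFunOnFinite.symm fun j => (α j : ℕ)
  have he : Function.Injective e := by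
    intro α β h
    funext j
    exact Fin.ext (by simpa [e] using DFunLike.congr_fun h j)
  let P : MvPolynomial (Fin d) ℝ := ∑ α, MvPolynomial.monomial (e α) (f (Pi.single α 1))
  have hP : P = 0 := by
    refine MvPolynomial.funext_set (fun _ => Set.Icc (0 : ℝ) 1)
      (fun _ => Set.Icc_infinite one_pos) fun v hv => ?_
    have hv' : WithLp.toLp 2 v ∈ unitCube d := fun j => hv j trivial
    have h0 : f (monomialVec d m (WithLp.toLp 2 v)) = 0 :=
      hf (Submodule.subset_span ⟨⟨_, hv'⟩, rfl⟩)
    rw [LinearMap.pi_apply_eq_sum_univ] at h0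
    simp only [P, map_sum, MvPolynomial.eval_monomial, map_zero]
    rw [← h0]
    refine Finset.sum_congr rfl fun α _ => ?_
    rw [Finsupp.prod_fintype _ _ (by simp), smul_eq_mul, mul_comm]
    congr 2
    ext β
    simp [Pi.single_apply, eq_comm]
  apply hf0
  refine LinearMap.pi_ext' fun α => LinearMap.ext_ring ?_
  have := congrArg (MvPolynomial.coeff (e α)) hP
  simpa [P, MvPolynomial.coeff_sum, MvPolynomial.coeff_monomial, he.eq_iff] using this

lemma exists_unisolvent (d m : ℕ) :
    ∃ p : (Fin d → Fin (m + 1)) → EuclideanSpace ℝ (Fin d),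
      (∀ k, p k ∈ unitCube d) ∧ (Matrix.of fun k => monomialVec d m (p k)).det ≠ 0 := by
  classical
  obtain ⟨κ, a, -, hspan, hli⟩ :=
    exists_linearIndependent' ℝ (fun y : unitCube d => monomialVec d m y)
  rw [span_monomialVec_unitCube] at hspan
  let b := Module.Basis.mk hli hspan.ge
  let e := (Pi.basisFun ℝ (Fin d → Fin (m + 1))).indexEquiv b
  refine ⟨fun k => a (e k), fun k => (a (e k)).2, ?_⟩
  rw [← isUnit_iff_ne_zero, ← Matrix.isUnit_iff_isUnit_det,
    ← Matrix.linearIndependent_rows_iff_isUnit]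
  exact hli.comp e e.injective

/-- The Lagrange basis for the nodes `q`, evaluated at `y`. -/
noncomputable def lagrangeVec {d m : ℕ} (q : (Fin d → Fin (m + 1)) → EuclideanSpace ℝ (Fin d))
    (y : EuclideanSpace ℝ (Fin d)) : (Fin d → Fin (m + 1)) → ℝ :=
  Matrix.vecMul (monomialVec d m y) (Matrix.of fun k => monomialVec d m (q k))⁻¹

lemma continuousOn_lagrangeVec (d m : ℕ) :
    ContinuousOn (fun z : ((Fin d → Fin (m + 1)) → EuclideanSpace ℝ (Fin d)) ×
        EuclideanSpace ℝ (Fin d) => lagrangeVec z.1 z.2)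
      {z | (Matrix.of fun k => monomialVec d m (z.1 k)).det ≠ 0} := by
  have hM : Continuous fun z : ((Fin d → Fin (m + 1)) → EuclideanSpace ℝ (Fin d)) ×
      EuclideanSpace ℝ (Fin d) => Matrix.of fun k => monomialVec d m (z.1 k) :=
    continuous_matrix fun k α =>
      (continuous_apply α).comp ((continuous_monomialVec d m).comp (by fun_prop))
  have hb : Continuous fun z : ((Fin d → Fin (m + 1)) → EuclideanSpace ℝ (Fin d)) ×
      EuclideanSpace ℝ (Fin d) => monomialVec d m z.2 :=
    (continuous_monomialVec d m).comp continuous_snd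
  have hadj := hb.matrix_vecMul hM.matrix_adjugate
  have : (fun z : ((Fin d → Fin (m + 1)) → EuclideanSpace ℝ (Fin d)) ×
      EuclideanSpace ℝ (Fin d) => lagrangeVec z.1 z.2) = fun z =>
      ((Matrix.of fun k => monomialVec d m (z.1 k)).det)⁻¹ •
        Matrix.vecMul (monomialVec d m z.2)
          (Matrix.of fun k => monomialVec d m (z.1 k)).adjugate := by
    funext z
    rw [lagrangeVec, Matrix.inv_def, Ring.inverse_eq_inv', Matrix.vecMul_smul]
  rw [this]
  exact (hM.matrix_det.continuousOn.inv₀ fun z hz => hz).smul hadj.continuousOn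

lemma eval_eq_sum_lagrangeVec {d m : ℕ}
    {q : (Fin d → Fin (m + 1)) → EuclideanSpace ℝ (Fin d)}
    (hq : (Matrix.of fun k => monomialVec d m (q k)).det ≠ 0)
    {π : MvPolynomial (Fin d) ℝ} (hπ : π.totalDegree ≤ m) (y : EuclideanSpace ℝ (Fin d)) :
    MvPolynomial.eval (fun j => y j) π =
      ∑ k, MvPolynomial.eval (fun j => q k j) π * lagrangeVec q y k := by
  have hmon : ∀ α, monomialVec d m y α = ∑ k, monomialVec d m (q k) α * lagrangeVec q y k := by
    intro α
    have h : Matrix.vecMul (lagrangeVec q y) (Matrix.of fun k => monomialVec d m (q k)) =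
        monomialVec d m y := by
      rw [lagrangeVec, Matrix.vecMul_vecMul, Matrix.nonsing_inv_mul _ (isUnit_iff_ne_zero.2 hq),
        Matrix.vecMul_one]
    conv_lhs => rw [← h]
    simp [Matrix.vecMul, dotProduct, mul_comm]
  simp only [MvPolynomial.eval_eq', Finset.sum_mul]
  rw [Finset.sum_comm]
  refine Finset.sum_congr rfl fun s hs => ?_
  have hdeg : ∀ j, s j < m + 1 := fun j =>
    Nat.lt_succ_of_le ((MvPolynomial.degreeOf_le_iff.1
      ((MvPolynomial.degreeOf_le_totalDegree π j).trans hπ)) s hs)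
  have := hmon fun j => ⟨s j, hdeg j⟩
  simp only [monomialVec] at this
  rw [this, Finset.mul_sum]
  exact Finset.sum_congr rfl fun k _ => by ring

lemma exists_stable_lagrange (d m : ℕ) :
    ∃ (p : (Fin d → Fin (m + 1)) → EuclideanSpace ℝ (Fin d)) (δ C : ℝ),
      (∀ k, p k ∈ unitCube d) ∧ 0 < δ ∧
      ∀ q : (Fin d → Fin (m + 1)) → EuclideanSpace ℝ (Fin d), (∀ k, dist (q k) (p k) ≤ δ) →
        (Matrix.of fun k => monomialVec d m (q k)).det ≠ 0 ∧
        ∀ y₀ ∈ unitCube d, ∀ y, dist y y₀ ≤ δ → ∑ k, |lagrangeVec q y k| ≤ C := by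
  obtain ⟨p, hp, hdet⟩ := exists_unisolvent d m
  have hcont : Continuous fun q : (Fin d → Fin (m + 1)) → EuclideanSpace ℝ (Fin d) =>
      (Matrix.of fun k => monomialVec d m (q k)).det :=
    Continuous.matrix_det (continuous_matrix fun k α =>
      (continuous_apply α).comp ((continuous_monomialVec d m).comp (continuous_apply k)))
  obtain ⟨δ, hδ, hball⟩ := Metric.nhds_basis_closedBall.mem_iff.1
    (hcont.continuousAt.eventually_ne hdet)
  have hK : IsCompact (Metric.closedBall p δ ×ˢ
      Metric.closedBall (0 : EuclideanSpace ℝ (Fin d)) (δ + √d)) :=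
    (isCompact_closedBall _ _).prod (isCompact_closedBall _ _)
  have hF : ContinuousOn (fun z : ((Fin d → Fin (m + 1)) → EuclideanSpace ℝ (Fin d)) ×
      EuclideanSpace ℝ (Fin d) => ∑ k, |lagrangeVec z.1 z.2 k|)
      (Metric.closedBall p δ ×ˢ Metric.closedBall 0 (δ + √d)) :=
    continuousOn_finsetSum _ fun k _ => (continuousOn_pi.1
      ((continuousOn_lagrangeVec d m).mono fun z hz => hball hz.1) k).abs
  obtain ⟨C, hC⟩ := hK.bddAbove_image hF
  refine ⟨p, δ, C, hp, hδ, fun q hq => ?_⟩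
  have hqB : q ∈ Metric.closedBall p δ := (dist_pi_le_iff hδ.le).2 hq
  refine ⟨hball hqB, fun y₀ hy₀ y hy => hC ⟨(q, y), ⟨hqB, ?_⟩, rfl⟩⟩
  rw [mem_closedBall_zero_iff]
  calc ‖y‖ = ‖(y - y₀) + y₀‖ := by rw [sub_add_cancel]
    _ ≤ ‖y - y₀‖ + ‖y₀‖ := norm_add_le _ _
    _ ≤ δ + √d := add_le_add (by rwa [← dist_eq_norm]) (norm_le_of_mem_unitCube hy₀)

lemma exists_eval_homothety {d : ℕ} (c : EuclideanSpace ℝ (Fin d)) (r : ℝ)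
    (π : MvPolynomial (Fin d) ℝ) :
    ∃ π' : MvPolynomial (Fin d) ℝ, π'.totalDegree ≤ π.totalDegree ∧
      ∀ y : EuclideanSpace ℝ (Fin d), MvPolynomial.eval (fun j => y j) π' =
        MvPolynomial.eval (fun j => (AffineMap.homothety c r y) j) π := by
  let T : Fin d → MvPolynomial (Fin d) ℝ := fun j =>
    MvPolynomial.C r * (MvPolynomial.X j - MvPolynomial.C (c j)) + MvPolynomial.C (c j)
  have hT : ∀ j, (T j).totalDegree ≤ 1 := fun j => by
    refine (MvPolynomial.totalDegree_add _ _).trans (max_le ?_ (by simp))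
    refine (MvPolynomial.totalDegree_mul _ _).trans ?_
    have := MvPolynomial.totalDegree_sub (MvPolynomial.X j) (MvPolynomial.C (c j))
    simpa using this
  refine ⟨∑ s ∈ π.support, MvPolynomial.C (π.coeff s) * ∏ j, T j ^ s j, ?_, fun y => ?_⟩
  · refine MvPolynomial.totalDegree_finsetSum_le fun s hs => ?_
    refine (MvPolynomial.totalDegree_mul _ _).trans ?_
    rw [MvPolynomial.totalDegree_C, zero_add]
    refine (MvPolynomial.totalDegree_finsetProd _ _).trans ?_
    refine le_trans ?_ (MvPolynomial.le_totalDegree hs)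
    rw [Finsupp.sum_fintype _ _ (by simp)]
    refine Finset.sum_le_sum fun j _ => (MvPolynomial.totalDegree_pow _ _).trans ?_
    exact (Nat.mul_le_mul_left _ (hT j)).trans (by simp)
  · simp [MvPolynomial.eval_eq' _ π, map_sum, map_prod, T, AffineMap.homothety_apply]

lemma continuous_lagrangeVec {d m : ℕ}
    (q : (Fin d → Fin (m + 1)) → EuclideanSpace ℝ (Fin d)) : Continuous (lagrangeVec q) :=
  (continuous_monomialVec d m).matrix_vecMul continuous_const

lemma dist_homothety_homothety {E : Type*} [NormedAddCommGroup E] [NormedSpace ℝ E]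
    (c x y : E) (r : ℝ) :
    dist (AffineMap.homothety c r x) (AffineMap.homothety c r y) = |r| * dist x y := by
  simp [AffineMap.homothety_apply, dist_eq_norm, ← smul_sub, norm_smul]

/-- The admissible weight vectors at `y`: those reproducing polynomials of degree at most `m`,
with absolute sum at most `C` and supported on the nodes at distance less than `R` from `y`. -/
def admissibleWeights {d n : ℕ} (m : ℕ) (C R : ℝ) (x : Fin n → EuclideanSpace ℝ (Fin d))
    (y : EuclideanSpace ℝ (Fin d)) : Set (Fin n → ℝ) :=
  {w | (∀ π : MvPolynomial (Fin d) ℝ, π.totalDegree ≤ m →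
      MvPolynomial.eval (fun j => y j) π = ∑ i, MvPolynomial.eval (fun j => x i j) π * w i) ∧
    ∑ i, |w i| ≤ C ∧ ∀ i, R ≤ ‖x i - y‖ → w i = 0}

lemma convex_admissibleWeights {d n : ℕ} (m : ℕ) (C R : ℝ)
    (x : Fin n → EuclideanSpace ℝ (Fin d)) (y : EuclideanSpace ℝ (Fin d)) :
    Convex ℝ (admissibleWeights m C R x y) := by
  intro v hv w hw a b ha hb hab
  refine ⟨fun π hπ => ?_, ?_, fun i hi => by simp [hv.2.2 i hi, hw.2.2 i hi]⟩
  · calc MvPolynomial.eval (fun j => y j) π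
        = a * MvPolynomial.eval (fun j => y j) π + b * MvPolynomial.eval (fun j => y j) π := by
          rw [← add_mul, hab, one_mul]
      _ = a * ∑ i, MvPolynomial.eval (fun j => x i j) π * v i +
          b * ∑ i, MvPolynomial.eval (fun j => x i j) π * w i := by
          rw [← hv.1 π hπ, ← hw.1 π hπ]
      _ = _ := by
          rw [Finset.mul_sum, Finset.mul_sum, ← Finset.sum_add_distrib]
          refine Finset.sum_congr rfl fun i _ => ?_
          simp only [Pi.add_apply, Pi.smul_apply, smul_eq_mul]
          ring
  · calc ∑ i, |(a • v + b • w) i| ≤ ∑ i, (a * |v i| + b * |w i|) :=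
          Finset.sum_le_sum fun i _ => by
            simpa [abs_mul, abs_of_nonneg ha, abs_of_nonneg hb] using
              abs_add_le (a * v i) (b * w i)
      _ = a * ∑ i, |v i| + b * ∑ i, |w i| := by
          rw [Finset.sum_add_distrib, Finset.mul_sum, Finset.mul_sum]
      _ ≤ a * C + b * C :=
          add_le_add (mul_le_mul_of_nonneg_left hv.2.1 ha) (mul_le_mul_of_nonneg_left hw.2.1 hb)
      _ = C := by rw [← add_mul, hab, one_mul]

lemma exists_local_weights {d n m : ℕ} {p : (Fin d → Fin (m + 1)) → EuclideanSpace ℝ (Fin d)}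
    {δ C : ℝ} (hp : ∀ k, p k ∈ unitCube d) (hδ : 0 < δ)
    (hstable : ∀ q : (Fin d → Fin (m + 1)) → EuclideanSpace ℝ (Fin d),
      (∀ k, dist (q k) (p k) ≤ δ) →
        (Matrix.of fun k => monomialVec d m (q k)).det ≠ 0 ∧
        ∀ y₀ ∈ unitCube d, ∀ y, dist y y₀ ≤ δ → ∑ k, |lagrangeVec q y k| ≤ C)
    {x : Fin n → EuclideanSpace ℝ (Fin d)} {ρ : ℝ} (hρ : 0 < ρ) (hρδ : ρ ≤ δ)
    (hcov : ∀ y ∈ unitCube d, ∃ i, dist y (x i) ≤ ρ)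
    {y₀ : EuclideanSpace ℝ (Fin d)} (hy₀ : y₀ ∈ unitCube d) :
    ∃ g : EuclideanSpace ℝ (Fin d) → Fin n → ℝ, Continuous g ∧
      ∀ y ∈ Metric.ball y₀ ρ, g y ∈ admissibleWeights m C ((2 + 2 * √d / δ) * ρ) x y := by
  classical
  set r : ℝ := ρ / δ with hr
  have hr0 : 0 < r := div_pos hρ hδ
  have hr1 : r ≤ 1 := (div_le_one hδ).2 hρδ
  have hrρ : r⁻¹ * ρ = δ := by rw [hr]; field_simp
  let S := AffineMap.homothety y₀ r
  let S' := AffineMap.homothety y₀ r⁻¹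
  have hS'S : ∀ z, S' (S z) = z := fun z => by
    simp only [S, S']
    rw [← AffineMap.homothety_mul_apply, inv_mul_cancel₀ hr0.ne', AffineMap.homothety_one,
      AffineMap.id_apply]
  have hSS' : ∀ z, S (S' z) = z := fun z => by
    simp only [S, S']
    rw [← AffineMap.homothety_mul_apply, mul_inv_cancel₀ hr0.ne', AffineMap.homothety_one,
      AffineMap.id_apply]
  have hScube : ∀ z ∈ unitCube d, S z ∈ unitCube d := fun z hz => by
    have := convex_unitCube d hy₀ hz (sub_nonneg.2 hr1) hr0.le (by ring)
    rwa [show S z = (1 - r) • y₀ + r • z by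
      simp only [S, AffineMap.homothety_apply, vsub_eq_sub, vadd_eq_add]
      module]
  choose a ha using fun k => hcov (S (p k)) (hScube _ (hp k))
  let q : (Fin d → Fin (m + 1)) → EuclideanSpace ℝ (Fin d) := fun k => S' (x (a k))
  have hq : ∀ k, dist (q k) (p k) ≤ δ := fun k => by
    rw [← hS'S (p k), dist_homothety_homothety, abs_of_pos (inv_pos.2 hr0), dist_comm, ← hrρ]
    exact mul_le_mul_of_nonneg_left (ha k) (inv_pos.2 hr0).le
  obtain ⟨hdet, hC⟩ := hstable q hq
  refine ⟨fun y i => ∑ k with a k = i, lagrangeVec q (S' y) k, ?_, fun y hy => ⟨?_, ?_, ?_⟩⟩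
  · have hS' : Continuous S' := by
      simp only [S']
      exact AffineMap.homothety_continuous _ _
    exact continuous_pi fun i => continuous_finsetSum _ fun k _ =>
      (continuous_apply k).comp ((continuous_lagrangeVec q).comp hS')
  · intro π hπ
    obtain ⟨π', hdeg, heval⟩ := exists_eval_homothety y₀ r π
    have h := eval_eq_sum_lagrangeVec hdet (hdeg.trans hπ) (S' y)
    simp only [heval] at h
    change MvPolynomial.eval (fun j => (S (S' y)) j) π = ∑ k,
      MvPolynomial.eval (fun j => (S (S' (x (a k)))) j) π * _ at h
    simp only [hSS'] at h
    rw [h, ← Finset.sum_fiberwise _ a]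
    refine Finset.sum_congr rfl fun i _ => ?_
    rw [Finset.mul_sum]
    refine Finset.sum_congr rfl fun k hk => ?_
    rw [(Finset.mem_filter.1 hk).2]
  · calc ∑ i, |∑ k with a k = i, lagrangeVec q (S' y) k|
        ≤ ∑ i, ∑ k with a k = i, |lagrangeVec q (S' y) k| :=
          Finset.sum_le_sum fun i _ => Finset.abs_sum_le_sum_abs _ _
      _ = ∑ k, |lagrangeVec q (S' y) k| := Finset.sum_fiberwise _ a _
      _ ≤ C := by
        refine hC y₀ hy₀ _ ?_
        calc dist (S' y) y₀ = dist (S' y) (S' y₀) := by simp [S']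
          _ = r⁻¹ * dist y y₀ := by
            rw [dist_homothety_homothety, abs_of_pos (inv_pos.2 hr0)]
          _ ≤ r⁻¹ * ρ := mul_le_mul_of_nonneg_left (Metric.mem_ball.1 hy).le (inv_pos.2 hr0).le
          _ = δ := hrρ
  · intro i hi
    refine Finset.sum_eq_zero fun k hk => absurd hi (not_le.2 ?_)
    obtain rfl := (Finset.mem_filter.1 hk).2
    have h1 : dist (S (p k)) y₀ ≤ r * (2 * √d) := by
      calc dist (S (p k)) y₀ = dist (S (p k)) (S y₀) := by simp [S]
        _ = r * dist (p k) y₀ := by rw [dist_homothety_homothety, abs_of_pos hr0]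
        _ ≤ r * (2 * √d) := by
          refine mul_le_mul_of_nonneg_left ?_ hr0.le
          rw [two_mul, dist_eq_norm]
          exact (norm_sub_le _ _).trans
            (add_le_add (norm_le_of_mem_unitCube (hp k)) (norm_le_of_mem_unitCube hy₀))
    have h2 : r * (2 * √d) = 2 * √d / δ * ρ := by rw [hr]; ring
    have h3 := dist_triangle4 (x (a k)) (S (p k)) y₀ y
    rw [dist_comm (x (a k)) (S (p k)), dist_comm y₀ y] at h3
    rw [← dist_eq_norm]
    linarith [ha k, Metric.mem_ball.1 hy]

lemma exists_dist_le_iSup_iInf {d n : ℕ} (hn : 1 ≤ n) {x : Fin n → EuclideanSpace ℝ (Fin d)}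
    (hx : ∀ i, x i ∈ unitCube d) {y : EuclideanSpace ℝ (Fin d)} (hy : y ∈ unitCube d) :
    ∃ i, dist y (x i) ≤
      ⨆ y : unitCube d, ⨅ i, ‖(y : EuclideanSpace ℝ (Fin d)) - x i‖ := by
  have : Nonempty (Fin n) := ⟨⟨0, hn⟩⟩
  obtain ⟨i, hi⟩ := exists_eq_ciInf_of_finite (f := fun i => ‖y - x i‖)
  refine ⟨i, ?_⟩
  rw [dist_eq_norm, hi]
  refine le_ciSup (f := fun y : unitCube d => ⨅ i, ‖(y : EuclideanSpace ℝ (Fin d)) - x i‖)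
    ⟨2 * √d, ?_⟩ ⟨y, hy⟩
  rintro _ ⟨z, rfl⟩
  refine (ciInf_le (Set.finite_range _).bddBelow ⟨0, hn⟩).trans ?_
  rw [two_mul]
  exact (norm_sub_le _ _).trans
    (add_le_add (norm_le_of_mem_unitCube z.2) (norm_le_of_mem_unitCube (hx _)))

lemma pos_of_forall_exists_dist_le {d n : ℕ} (hd : 1 ≤ d)
    {x : Fin n → EuclideanSpace ℝ (Fin d)} {ρ : ℝ}
    (hcov : ∀ y ∈ unitCube d, ∃ i, dist y (x i) ≤ ρ) : 0 < ρ := by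
  by_contra! h
  refine infinite_unitCube hd ((Set.finite_range x).subset fun y hy => ?_)
  obtain ⟨i, hi⟩ := hcov y hy
  exact ⟨i, (dist_le_zero.1 (hi.trans h)).symm⟩

/-- Properties of the moving least squares weights: for any point set in the unit
cube with sufficiently small covering radius `ρ`, there exist continuous weights
`uᵢ` that reproduce polynomials of total degree at most `s - 1`, have absolute
sums uniformly bounded by `a₁`, and are locally supported at scale `a₂ · ρ`. -/
theorem moving_least_squares_weights (d s : ℕ) (hd : 1 ≤ d) (hs : 1 ≤ s) :
    ∃ a₁ a₂ ρ₀ : ℝ, 0 < a₁ ∧ 0 < a₂ ∧ 0 < ρ₀ ∧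
      ∀ (n : ℕ), 1 ≤ n → ∀ x : Fin n → EuclideanSpace ℝ (Fin d),
        (∀ i, ∀ j, x i j ∈ Set.Icc (0 : ℝ) 1) →
        ∀ ρ : ℝ,
          ρ = (⨆ y : {z : EuclideanSpace ℝ (Fin d) | ∀ j, z j ∈ Set.Icc (0 : ℝ) 1},
            ⨅ i, ‖(y : EuclideanSpace ℝ (Fin d)) - x i‖) →
          ρ ≤ ρ₀ →
          ∃ u : Fin n → EuclideanSpace ℝ (Fin d) → ℝ,
            (∀ i, ContinuousOn (u i)
              {z : EuclideanSpace ℝ (Fin d) | ∀ j, z j ∈ Set.Icc (0 : ℝ) 1}) ∧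
            (∀ π : MvPolynomial (Fin d) ℝ, π.totalDegree ≤ s - 1 →
              ∀ y : EuclideanSpace ℝ (Fin d), (∀ j, y j ∈ Set.Icc (0 : ℝ) 1) →
                MvPolynomial.eval (fun j => y j) π =
                  ∑ i, MvPolynomial.eval (fun j => x i j) π * u i y) ∧
            (∀ y : EuclideanSpace ℝ (Fin d), (∀ j, y j ∈ Set.Icc (0 : ℝ) 1) →
              ∑ i, |u i y| ≤ a₁) ∧
            (∀ y : EuclideanSpace ℝ (Fin d), (∀ j, y j ∈ Set.Icc (0 : ℝ) 1) →
              ∀ i, a₂ * ρ ≤ ‖x i - y‖ → u i y = 0) := by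
  obtain ⟨p, δ, C, hp, hδ, hstable⟩ := exists_stable_lagrange d (s - 1)
  refine ⟨max C 1, 2 + 2 * √d / δ, δ, by positivity, by positivity, hδ, ?_⟩
  intro n hn x hx ρ hρ hρδ
  have hcov : ∀ y ∈ unitCube d, ∃ i, dist y (x i) ≤ ρ := fun y hy => by
    rw [hρ]
    exact exists_dist_le_iSup_iInf hn hx hy
  have hρ0 : 0 < ρ := pos_of_forall_exists_dist_le hd hcov
  obtain ⟨g, hg⟩ := exists_continuous_forall_mem_convex_of_local
    (t := fun y => {w | y ∈ unitCube d →
      w ∈ admissibleWeights (s - 1) C ((2 + 2 * √d / δ) * ρ) x y})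
    (fun y => by
      by_cases hy : y ∈ unitCube d
      · simpa [hy] using convex_admissibleWeights _ _ _ _ _
      · simpa [hy] using convex_univ)
    (fun y₀ => by
      by_cases hy₀ : y₀ ∈ unitCube d
      · obtain ⟨g, hgc, hg⟩ := exists_local_weights hp hδ hstable hρ0 hρδ hcov hy₀
        exact ⟨_, Metric.ball_mem_nhds _ hρ0, g, hgc.continuousOn, fun y hy _ => hg y hy⟩
      · exact ⟨_, (isClosed_unitCube d).isOpen_compl.mem_nhds hy₀, 0, continuousOn_const,
          fun y hy hy' => absurd hy' hy⟩)
  exact ⟨fun i y => g y i, fun i => ((continuous_apply i).comp g.continuous).continuousOn,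
    fun π hπ y hy => (hg y hy).1 π hπ, fun y hy => (hg y hy).2.1.trans (le_max_left _ _),
    fun y hy => (hg y hy).2.2⟩
end
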